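/- arXiv:2309.00991 — 3 statements merged into one kernel-verified Lean document; each statement's English description precedes it below -/
import Mathlib

section
/- For every integer r ≥ 2, the theory T_r is complete: it is satisfiable, and for every sentence φ of the first-order language of graphs, either φ holds in every model of T_r or ¬φ holds in every model of T_r. -/
open FirstOrder Language

namespace RegularTree

/-- The conjunction of a list of bounded formulas. -/
def listInf {L : Language} {α : Type} {n : ℕ} (l : List (L.BoundedFormula α n)) :
    L.BoundedFormula α n :=
  l.foldr (· ⊓ ·) ⊤

/-- The disjunction of a list of bounded formulas. -/
def listSup {L : Language} {α : Type} {n : ℕ} (l : List (L.BoundedFormula α n)) :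
    L.BoundedFormula α n :=
  l.foldr (· ⊔ ·) ⊥

/-- Existentially quantify all bound variables except the first one. -/
def exsTail {L : Language} {α : Type} :
    ∀ {n : ℕ}, L.BoundedFormula α (n + 1) → L.BoundedFormula α 1
  | 0, φ => φ
  | _ + 1, φ => exsTail φ.ex

/-- The sentence asserting that every vertex has exactly `r` pairwise distinct
`R`-neighbors: `∀x ∃y₁…y_r ((⋀_{i<j} yᵢ ≠ yⱼ) ∧ (⋀_i x R yᵢ) ∧ ∀z (x R z → ⋁_i z = yᵢ))`. -/
def exactDegSentence (r : ℕ) : Language.graph.Sentence :=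
  (exsTail (listInf
    ((((List.finRange r ×ˢ List.finRange r).filter fun ij => ij.1 < ij.2).map
        fun ij => ∼((&ij.1.succ) =' (&ij.2.succ))) ++
      ((List.finRange r).map fun i => adj.boundedFormula₂ (&0) (&i.succ)) ++
      [∀'(adj.boundedFormula₂ (&0) (&(Fin.last (r + 1))) ⟹
          listSup ((List.finRange r).map fun i =>
            (&(Fin.last (r + 1))) =' (&i.succ.castSucc)))]))).all

/-- The sentence asserting that there is no cycle of length `n`: there are no pairwise
distinct `y₁, …, yₙ` with `y₁ R y₂, …, y_{n-1} R yₙ` and `yₙ R y₁`. -/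
def noCycleSentence (n : ℕ) : Language.graph.Sentence :=
  ∼(BoundedFormula.exs (listInf
    ((((List.finRange n ×ˢ List.finRange n).filter fun ij => ij.1 < ij.2).map
        fun ij => ∼((&ij.1) =' (&ij.2))) ++
      ((List.finRange n).map fun i => adj.boundedFormula₂ (&i) (&(finRotate n i))))))

/-- The theory `T_r` of the `r`-regular infinite tree: the theory of simple graphs
(irreflexivity and symmetry of `R`), together with the sentence that every vertex has
exactly `r` distinct neighbors, and, for each `n ≥ 3`, the sentence that there is no
cycle of length `n`. -/
def Tr (r : ℕ) : Language.graph.Theory :=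
  Theory.simpleGraph ∪ {exactDegSentence r} ∪ {σ | ∃ n, 3 ≤ n ∧ σ = noCycleSentence n}

variable {V : Type*}

/-- Every vertex of `G` has exactly `r` neighbors. -/
def IsRegular (G : SimpleGraph V) (r : ℕ) : Prop :=
  ∀ x, ∃ y : Fin r → V, Function.Injective y ∧ ∀ z, G.Adj x z ↔ ∃ i, y i = z

/-- `G` has no cycle of length at least `3`, a cycle being an injective cyclic sequence of
vertices. -/
def NoCycle (G : SimpleGraph V) : Prop :=
  ∀ n, 3 ≤ n → ¬∃ y : Fin n → V, Function.Injective y ∧ ∀ i, G.Adj (y i) (y (finRotate n i))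

theorem NoCycle.isAcyclic {G : SimpleGraph V} (h : NoCycle G) : G.IsAcyclic := by
  intro v c hc
  refine h c.length hc.three_le_length ⟨fun i => c.getVert i, fun i j hij => ?_, fun i => ?_⟩
  · refine Fin.ext (hc.getVert_injOn' ?_ ?_ hij) <;> simp only [Set.mem_ofPred_eq] <;> omega
  · have hadj := c.adj_getVert_succ i.2
    obtain ⟨n, hn⟩ : ∃ n, c.length = n + 1 := ⟨c.length - 1, by have := i.2; omega⟩
    have key : c.getVert (finRotate c.length i) = c.getVert (i + 1) := by
      have hval : ∀ m (hm : m = n + 1) (i : Fin m),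
          (finRotate m i : ℕ) = if (i : ℕ) = n then 0 else (i : ℕ) + 1 := by
        rintro m rfl i
        rw [coe_finRotate]
        simp [Fin.ext_iff]
      rw [hval _ hn i]
      split_ifs with hi
      · rw [hi, ← hn]
        simp
      · rfl
    rwa [← key] at hadj

/-- Vertices of the `(s + 1)`-regular tree: the root, or a branch at the root followed by a
list of choices (the latest choice first) of one of `s` children. -/
abbrev TreeVert (s : ℕ) : Type := Option (Fin (s + 1) × List (Fin s))

/-- The parent of a vertex different from the root. -/
def parent {s : ℕ} : Fin (s + 1) × List (Fin s) → TreeVert s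
  | (_, []) => none
  | (i, _ :: l) => some (i, l)

/-- The distance of a vertex to the root. -/
def height {s : ℕ} : TreeVert s → ℕ
  | none => 0
  | some d => d.2.length + 1

theorem height_some {s : ℕ} (d : Fin (s + 1) × List (Fin s)) :
    height (some d) = height (parent d) + 1 := by
  obtain ⟨i, _ | ⟨j, l⟩⟩ := d <;> rfl

/-- The `(s + 1)`-regular tree. -/
def regularTree (s : ℕ) : SimpleGraph (TreeVert s) where
  Adj a b := (∃ d, b = some d ∧ parent d = a) ∨ ∃ d, a = some d ∧ parent d = b
  symm := ⟨fun _ _ h => h.symm⟩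
  loopless := ⟨by
    rintro a (⟨d, h, h'⟩ | ⟨d, h, h'⟩) <;>
    · have := height_some d
      rw [← h, h'] at this
      omega⟩

theorem regularTree_adj_parent {s : ℕ} (d : Fin (s + 1) × List (Fin s)) :
    (regularTree s).Adj (parent d) (some d) :=
  Or.inl ⟨d, rfl, rfl⟩

theorem regularTree_isRegular (s : ℕ) : IsRegular (regularTree s) (s + 1) := by
  rintro (_ | ⟨i, l⟩)
  · refine ⟨fun i => some (i, []), fun i j h => by simpa using h, fun z => ⟨?_, ?_⟩⟩
    · rintro (⟨⟨i, _ | ⟨j, l⟩⟩, rfl, h⟩ | ⟨d, h, -⟩)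
      · exact ⟨i, rfl⟩
      · simp [parent] at h
      · simp at h
    · rintro ⟨i, rfl⟩
      exact regularTree_adj_parent (i, [])
  · refine ⟨Fin.cons (parent (i, l)) fun j => some (i, j :: l), ?_, fun z => ⟨?_, ?_⟩⟩
    · rw [Fin.cons_injective_iff]
      refine ⟨?_, fun j k h => by simpa using h⟩
      rintro ⟨j, h⟩
      have h1 := height_some (i, l)
      rw [← h] at h1
      simp [height] at h1
    · rintro (⟨⟨i', _ | ⟨j, l'⟩⟩, rfl, h⟩ | ⟨d, h, rfl⟩)
      · simp [parent] at h
      · simp only [parent, Option.some.injEq, Prod.mk.injEq] at h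
        obtain ⟨rfl, rfl⟩ := h
        exact ⟨j.succ, by simp⟩
      · obtain rfl := Option.some.inj h
        exact ⟨0, by simp⟩
    · rintro ⟨j, rfl⟩
      refine Fin.cases ?_ (fun j => ?_) j
      · exact (regularTree_adj_parent (i, l)).symm
      · exact regularTree_adj_parent (i, j :: l)

theorem regularTree_eq_of_height_le {s : ℕ} {a b c : TreeVert s} (hb : (regularTree s).Adj a b)
    (hc : (regularTree s).Adj a c) (hba : height b ≤ height a) (hca : height c ≤ height a) :
    b = c := by
  rcases hb with ⟨d, rfl, rfl⟩ | ⟨d, rfl, rfl⟩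
  · have := height_some d
    omega
  · rcases hc with ⟨e, rfl, h⟩ | ⟨e, h, rfl⟩
    · have := height_some e
      rw [h] at this
      omega
    · rw [Option.some.inj h]

theorem regularTree_noCycle (s : ℕ) : NoCycle (regularTree s) := by
  rintro n hn ⟨y, hy, hadj⟩
  obtain ⟨n, rfl⟩ : ∃ m, n = m + 3 := ⟨n - 3, by omega⟩
  obtain ⟨i, hi⟩ := Finite.exists_max fun i => height (y i)
  have h1 := hadj i
  have h2 := hadj ((finRotate _).symm i)
  rw [Equiv.apply_symm_apply] at h2
  have h3 := hy (regularTree_eq_of_height_le h1 h2.symm (hi _) (hi _))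
  rw [finRotate_apply, finRotate_symm_apply, eq_sub_iff_add_eq, add_assoc, add_eq_left,
    Fin.ext_iff, Fin.val_add] at h3
  have h4 : (2 : ℕ) % (n + 3) = 0 := by simpa using h3
  rw [Nat.mod_eq_of_lt (by omega)] at h4
  omega

theorem IsRegular.exists_children {G : SimpleGraph V} {s : ℕ} (hG : IsRegular G (s + 1))
    {p x : V} (h : G.Adj p x) :
    ∃ c : Fin s → V, Function.Injective c ∧ ∀ z, (∃ i, c i = z) ↔ G.Adj x z ∧ z ≠ p := by
  obtain ⟨y, hy, hyz⟩ := hG x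
  obtain ⟨k, rfl⟩ := (hyz p).1 h.symm
  refine ⟨y ∘ k.succAbove, hy.comp Fin.succAbove_right_injective, fun z => ⟨?_, ?_⟩⟩
  · rintro ⟨i, rfl⟩
    exact ⟨(hyz _).2 ⟨_, rfl⟩, fun h => Fin.succAbove_ne k i (hy h)⟩
  · rintro ⟨hz, hne⟩
    obtain ⟨j, rfl⟩ := (hyz z).1 hz
    obtain ⟨i, rfl⟩ := Fin.exists_succAbove_eq (x := j) (y := k) fun h => hne (by rw [h])
    exact ⟨i, rfl⟩

/-- Starting from the vertex `v`, whose neighbors are listed by `e`, follow a list of choices in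
the graph where `c p x` lists the neighbors of `x` different from `p`. The result is the
last edge traversed. -/
def lastEdge {s : ℕ} (v : V) (e : Fin (s + 1) → V) (c : V → V → Fin s → V) (i : Fin (s + 1)) :
    List (Fin s) → V × V
  | [] => (v, e i)
  | j :: l => ((lastEdge v e c i l).2, c (lastEdge v e c i l).1 (lastEdge v e c i l).2 j)

/-- The unfolding of an `(s + 1)`-regular forest at a vertex `v` identifies the `(s + 1)`-regular
tree with the connected component of `v`. -/
theorem exists_embedding_component {G : SimpleGraph V} {s : ℕ} (hG : IsRegular G (s + 1))
    (hac : G.IsAcyclic) (v : V) :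
    ∃ f : regularTree s ↪g G, ∀ x, G.Reachable v x ↔ x ∈ Set.range f := by
  obtain ⟨e, he, hev⟩ := hG v
  have : Nonempty V := ⟨v⟩
  have hc : ∀ p x, G.Adj p x → ∃ c : Fin s → V, Function.Injective c ∧
      ∀ z, (∃ i, c i = z) ↔ G.Adj x z ∧ z ≠ p := fun p x h => hG.exists_children h
  choose! c hcinj hcz using hc
  let D := lastEdge v e c
  let F : TreeVert s → V := fun a => a.elim v fun d => (D d.1 d.2).2
  have hparent : ∀ d, (D d.1 d.2).1 = F (parent d) := by
    rintro ⟨i, _ | ⟨j, l⟩⟩ <;> rfl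
  have hpath : ∀ i l, G.Adj (D i l).1 (D i l).2 ∧
      ∃ q : G.Walk v (D i l).1, q.IsPath ∧ (D i l).2 ∉ q.support := by
    intro i l
    induction l with
    | nil =>
      have h := (hev (e i)).2 ⟨i, rfl⟩
      exact ⟨h, (.nil : G.Walk v v), .nil, fun hmem => h.ne' (List.mem_singleton.1 hmem)⟩
    | cons j l ih =>
      obtain ⟨hadj, q, hq, hx⟩ := ih
      have h := (hcz _ _ hadj _).1 ⟨j, rfl⟩
      refine ⟨h.1, q.concat hadj, hq.concat hx hadj, fun hmem => h.2 ?_⟩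
      have := hac.eq_penultimate_of_adj_end (hq.concat hx hadj) h.1 hmem
      simpa using this
  have hD : ∀ i l i' l', (D i l).2 = (D i' l').2 → D i l = D i' l' := by
    intro i l i' l' h
    obtain ⟨hadj, q, hq, hx⟩ := hpath i l
    obtain ⟨hadj', q', hq', hx'⟩ := hpath i' l'
    generalize D i l = a at *
    generalize D i' l' = b at *
    obtain ⟨p, x⟩ := a
    obtain ⟨p', x'⟩ := b
    obtain rfl : x = x' := h
    have := (hac.subsingleton_path v x).elim ⟨_, hq.concat hx hadj⟩ ⟨_, hq'.concat hx' hadj'⟩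
    have := congrArg (fun w : G.Path v x => w.1.penultimate) this
    simp only [SimpleGraph.Walk.penultimate_concat] at this
    rw [this]
  have hv : ∀ i l, (D i l).2 ≠ v := by
    intro i l h
    obtain ⟨-, q, -, hx⟩ := hpath i l
    rw [h] at hx
    exact hx q.start_mem_support
  have hDinj : ∀ l i l' i', D i l = D i' l' → i = i' ∧ l = l' := by
    intro l
    induction l with
    | nil =>
      rintro i (_ | ⟨j', l'⟩) i' h
      · exact ⟨he (congrArg Prod.snd h), rfl⟩
      · exact absurd (congrArg Prod.fst h).symm (hv i' l')
    | cons j l ih =>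
      rintro i (_ | ⟨j', l'⟩) i' h
      · exact absurd (congrArg Prod.fst h) (hv i l)
      · have hl := hD i l i' l' (congrArg Prod.fst h)
        obtain ⟨rfl, rfl⟩ := ih _ _ _ hl
        have := hcinj _ _ (hpath i l).1 (congrArg Prod.snd h)
        exact ⟨rfl, by rw [this]⟩
  have hF : Function.Injective F := by
    rintro (_ | ⟨i, l⟩) (_ | ⟨i', l'⟩) h
    · rfl
    · exact absurd h.symm (hv i' l')
    · exact absurd h (hv i l)
    · obtain ⟨rfl, rfl⟩ := hDinj _ _ _ _ (hD i l i' l' h)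
      rfl
  have hchild : ∀ d, G.Adj (F (parent d)) (F (some d)) := fun d => by
    rw [← hparent]
    exact (hpath d.1 d.2).1
  have hhom : ∀ a b, (regularTree s).Adj a b → G.Adj (F a) (F b) := by
    rintro a b (⟨d, rfl, rfl⟩ | ⟨d, rfl, rfl⟩)
    · exact hchild d
    · exact (hchild d).symm
  have hlift : ∀ a z, G.Adj (F a) z → ∃ b, (regularTree s).Adj a b ∧ F b = z := by
    rintro (_ | ⟨i, l⟩) z h
    · obtain ⟨i, rfl⟩ := (hev z).1 h
      exact ⟨_, regularTree_adj_parent (i, []), rfl⟩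
    · by_cases hz : z = (D i l).1
      · exact ⟨_, (regularTree_adj_parent (i, l)).symm, by rw [hz, ← hparent]⟩
      · obtain ⟨j, rfl⟩ := (hcz _ _ (hpath i l).1 z).2 ⟨h, hz⟩
        exact ⟨_, regularTree_adj_parent (i, j :: l), rfl⟩
  refine ⟨⟨⟨F, hF⟩, ⟨fun h => ?_, hhom _ _⟩⟩, fun x => ⟨?_, ?_⟩⟩
  · obtain ⟨b, hb, hFb⟩ := hlift _ _ h
    rwa [← hF hFb]
  · rintro ⟨w₀⟩
    have : ∀ (u x : V) (_ : G.Walk u x), u ∈ Set.range F → x ∈ Set.range F := by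
      intro u x w
      induction w with
      | nil => exact id
      | cons h _ ih =>
        rintro ⟨a, rfl⟩
        obtain ⟨b, -, hb⟩ := hlift _ _ h
        exact ih ⟨b, hb⟩
    exact this v x w₀ ⟨none, rfl⟩
  · have hD' : ∀ l i, G.Reachable v (D i l).2 := by
      intro l i
      obtain ⟨hadj, q, -, -⟩ := hpath i l
      exact ⟨q.concat hadj⟩
    rintro ⟨_ | ⟨i, l⟩, rfl⟩
    · exact .rfl
    · exact hD' l i

/-- An `(s + 1)`-regular forest is a disjoint union of copies of the `(s + 1)`-regular tree. -/
theorem exists_equiv_component_prod {G : SimpleGraph V} {s : ℕ} (hG : IsRegular G (s + 1))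
    (hac : G.IsAcyclic) :
    ∃ e : G.ConnectedComponent × TreeVert s ≃ V, ∀ a b,
      G.Adj (e a) (e b) ↔ a.1 = b.1 ∧ (regularTree s).Adj a.2 b.2 := by
  choose f hf using exists_embedding_component hG hac
  let F : G.ConnectedComponent × TreeVert s → V := fun a => f a.1.out a.2
  have hcomp : ∀ a, G.connectedComponentMk (F a) = a.1 := by
    intro a
    have := (hf a.1.out (F a)).2 ⟨a.2, rfl⟩
    rw [← SimpleGraph.ConnectedComponent.sound this]
    exact Quot.out_eq _
  have hF : Function.Bijective F := by
    refine ⟨fun a b h => ?_, fun x => ?_⟩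
    · obtain ⟨C, a⟩ := a
      obtain ⟨C', b⟩ := b
      obtain rfl : C = C' := (hcomp (C, a)).symm.trans ((congrArg _ h).trans (hcomp (C', b)))
      exact congrArg _ ((f C.out).injective h)
    · have : G.Reachable (G.connectedComponentMk x).out x :=
        SimpleGraph.ConnectedComponent.exact (Quot.out_eq _)
      obtain ⟨a, ha⟩ := (hf _ x).1 this
      exact ⟨(_, a), ha⟩
  refine ⟨.ofBijective F hF, fun a b => ⟨fun h => ?_, ?_⟩⟩
  · have hab : a.1 = b.1 := by
      rw [← hcomp a, ← hcomp b]
      exact SimpleGraph.ConnectedComponent.sound h.reachable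
    refine ⟨hab, (f a.1.out).map_rel_iff.1 ?_⟩
    obtain ⟨C, b⟩ := b
    subst hab
    exact h
  · obtain ⟨C, a⟩ := a
    obtain ⟨C', b⟩ := b
    rintro ⟨rfl, h⟩
    exact (f C.out).map_rel_iff.2 h

open Cardinal in
theorem nonempty_iso_of_mk_eq {V W : Type} {G : SimpleGraph V} {H : SimpleGraph W} {s : ℕ}
    (hG : IsRegular G (s + 1)) (hGa : G.IsAcyclic) (hH : IsRegular H (s + 1)) (hHa : H.IsAcyclic)
    (hV : ℵ₀ < #V) (hVW : #V = #W) : Nonempty (G ≃g H) := by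
  obtain ⟨e, he⟩ := exists_equiv_component_prod hG hGa
  obtain ⟨e', he'⟩ := exists_equiv_component_prod hH hHa
  have key : ∀ C X : Type, ℵ₀ < #X → Nonempty (C × TreeVert s ≃ X) → #C = #X := by
    rintro C X hX ⟨g⟩
    have h1 : #C * #(TreeVert s) = #X := by rw [← g.cardinal_eq]; simp
    have h2 : #(TreeVert s) ≤ ℵ₀ := mk_le_aleph0
    have h3 : ℵ₀ < #C := by
      by_contra! h
      exact absurd ((mul_le_mul' h h2).trans aleph0_mul_aleph0.le) (by rw [h1]; exact hX.not_ge)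
    rw [← h1, mul_eq_left h3.le (h2.trans h3.le) (mk_ne_zero _)]
  obtain ⟨g⟩ := Cardinal.eq.1 (((key _ _ hV ⟨e⟩).trans hVW).trans
    (key _ _ (hVW ▸ hV) ⟨e'⟩).symm)
  refine ⟨⟨(e.symm.trans (g.prodCongr (.refl _))).trans e', fun {a b} => ?_⟩⟩
  simp only [Equiv.trans_apply]
  rw [he']
  obtain ⟨a, rfl⟩ := e.surjective a
  obtain ⟨b, rfl⟩ := e.surjective b
  rw [he]
  simp

theorem realize_exsTail {L : Language} {α M : Type} [L.Structure M] (v : α → M) :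
    ∀ {n : ℕ} (φ : L.BoundedFormula α (n + 1)) (x : Fin 1 → M),
      (exsTail φ).Realize v x ↔
        ∃ y : Fin n → M, φ.Realize v (Fin.cons (α := fun _ => M) (x 0) y)
  | 0, φ, x => by
    have : ∀ y : Fin 0 → M, (Fin.cons (x 0) y : Fin 1 → M) = x := fun y => by
      ext i
      fin_cases i
      rfl
    simp [exsTail, this]
  | n + 1, φ, x => by
    rw [exsTail, realize_exsTail v φ.ex x]
    simp only [BoundedFormula.realize_ex]
    constructor
    · rintro ⟨y, a, h⟩
      exact ⟨Fin.snoc y a, by rwa [Fin.cons_snoc_eq_snoc_cons]⟩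
    · rintro ⟨y, h⟩
      refine ⟨Fin.init y, y (Fin.last n), ?_⟩
      rwa [← Fin.cons_snoc_eq_snoc_cons, Fin.snoc_init_self]

theorem injective_iff_forall_lt_ne {n : ℕ} {X : Type*} (y : Fin n → X) :
    Function.Injective y ↔ ∀ i j, i < j → y i ≠ y j :=
  ⟨fun h _ _ hij e => hij.ne (h e), fun h i j e => by
    rcases lt_trichotomy i j with hij | hij | hij
    · exact absurd e (h i j hij)
    · exact hij
    · exact absurd e.symm (h j i hij)⟩

theorem realize_exactDegSentence {M : Type} (G : SimpleGraph M) (r : ℕ) :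
    letI := G.structure
    M ⊨ exactDegSentence r ↔ IsRegular G r := by
  let := G.structure
  have hadj : ∀ a b : M, Structure.RelMap adj ![a, b] ↔ G.Adj a b := fun _ _ => Iff.rfl
  rw [exactDegSentence, Sentence.Realize, Formula.Realize, BoundedFormula.realize_all]
  refine forall_congr' fun x => ?_
  rw [realize_exsTail]
  refine exists_congr fun y => ?_
  have hx : (Fin.snoc default x : Fin 1 → M) 0 = x := rfl
  have hsnoc : ∀ (a : M) (i : Fin r),
      (Fin.snoc (Fin.cons x y : Fin (r + 1) → M) a : Fin (r + 2) → M) i.castSucc.succ = y i :=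
    fun a i => by
      rw [Fin.succ_castSucc, Fin.snoc_castSucc (α := fun _ => M), Fin.cons_succ]
  rw [listInf, BoundedFormula.realize_foldr_inf]
  simp only [List.forall_mem_append, List.forall_mem_map, List.forall_mem_singleton]
  simp [listSup, BoundedFormula.realize_foldr_sup, hadj, injective_iff_forall_lt_ne, hx, hsnoc]
  rw [and_assoc]
  refine and_congr_right fun _ => ⟨fun h z => ⟨fun hz => ?_, ?_⟩, fun h => ⟨fun j => ?_, ?_⟩⟩
  · exact (h.2 z hz).imp fun _ => Eq.symm
  · rintro ⟨i, rfl⟩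
    exact h.1 i
  · exact (h _).2 ⟨j, rfl⟩
  · exact fun a ha => ((h a).1 ha).imp fun _ => Eq.symm

theorem realize_noCycleSentence {M : Type} (G : SimpleGraph M) (n : ℕ) :
    letI := G.structure
    M ⊨ noCycleSentence n ↔
      ¬∃ y : Fin n → M, Function.Injective y ∧ ∀ i, G.Adj (y i) (y (finRotate n i)) := by
  let := G.structure
  have hadj : ∀ a b : M, Structure.RelMap adj ![a, b] ↔ G.Adj a b := fun _ _ => Iff.rfl
  rw [noCycleSentence, Sentence.realize_not, Sentence.Realize, BoundedFormula.realize_exs]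
  refine not_congr (exists_congr fun y => ?_)
  rw [listInf, BoundedFormula.realize_foldr_inf]
  simp only [List.forall_mem_append, List.forall_mem_map]
  simp [hadj, injective_iff_forall_lt_ne]

theorem model_Tr_iff {M : Type} (G : SimpleGraph M) (r : ℕ) :
    letI := G.structure
    M ⊨ Tr r ↔ IsRegular G r ∧ NoCycle G := by
  let := G.structure
  rw [Tr, Theory.model_union_iff, Theory.model_union_iff, Theory.model_singleton_iff,
    realize_exactDegSentence, Theory.model_iff {σ | _}]
  refine and_congr (and_iff_right (simpleGraph_model G)) ⟨fun h n hn => ?_, ?_⟩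
  · exact (realize_noCycleSentence G n).1 (h _ ⟨n, hn, rfl⟩)
  · rintro h _ ⟨n, hn, rfl⟩
    exact (realize_noCycleSentence G n).2 (h n hn)

theorem exists_simpleGraph_of_model {M : Type} [S : Language.graph.Structure M] {r : ℕ}
    (h : M ⊨ Tr r) :
    ∃ G : SimpleGraph M, G.structure = S ∧ IsRegular G r ∧ NoCycle G := by
  have : M ⊨ Theory.simpleGraph := h.mono fun σ hσ => Or.inl (Or.inl hσ)
  refine ⟨simpleGraphOfStructure M, structure_simpleGraphOfStructure, ?_⟩
  rw [← model_Tr_iff, structure_simpleGraphOfStructure]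
  exact h

theorem nonempty_equiv_of_iso {M N : Type} {G : SimpleGraph M} {H : SimpleGraph N} (e : G ≃g H) :
    letI := G.structure
    letI := H.structure
    Nonempty (M ≃[Language.graph] N) := by
  let := G.structure
  let := H.structure
  exact ⟨⟨e.toEquiv, fun f => isEmptyElim f, fun {n} R x => by
    cases R
    exact e.map_rel_iff⟩⟩

theorem card_graph_le_aleph0 : Language.graph.card ≤ Cardinal.aleph0 := by
  have h2 : ∀ n, Countable (Language.graph.Relations n) := fun n => inferInstance
  have : Countable Language.graph.Symbols :=
    inferInstanceAs (Countable ((Σ _ : ℕ, Empty) ⊕ Σ n, Language.graph.Relations n))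
  exact Cardinal.mk_le_aleph0

/-- For every integer `r ≥ 2`, the theory `T_r` is complete: it is
satisfiable, and every sentence of the language of graphs is either a consequence of
`T_r` or its negation is. -/
theorem Tr_isComplete (r : ℕ) (hr : 2 ≤ r) : (Tr r).IsComplete := by
  obtain ⟨s, rfl⟩ : ∃ s, r = s + 1 := ⟨r - 1, by omega⟩
  have : NeZero s := ⟨by omega⟩
  refine Cardinal.Categorical.isComplete (Cardinal.aleph 1) (Tr (s + 1)) ?_
    (Cardinal.aleph0_le_aleph 1) ?_ ?_ ?_
  · rintro ⟨M⟩ ⟨N⟩ hM hN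
    obtain ⟨G, rfl, hG, hGc⟩ := exists_simpleGraph_of_model ‹M ⊨ Tr (s + 1)›
    obtain ⟨H, rfl, hH, hHc⟩ := exists_simpleGraph_of_model ‹N ⊨ Tr (s + 1)›
    obtain ⟨e⟩ := nonempty_iso_of_mk_eq hG hGc.isAcyclic hH hHc.isAcyclic
      ((Cardinal.aleph0_lt_aleph_one).trans_eq hM.symm) (hM.trans hN.symm)
    exact nonempty_equiv_of_iso e
  · rw [Cardinal.lift_le]
    exact card_graph_le_aleph0.trans (Cardinal.aleph0_le_aleph 1)
  · let := (regularTree s).structure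
    have := (model_Tr_iff (regularTree s) (s + 1)).2
      ⟨regularTree_isRegular s, regularTree_noCycle s⟩
    exact Theory.Model.isSatisfiable (TreeVert s)
  · intro M
    obtain ⟨G, -, hG, hc⟩ := exists_simpleGraph_of_model M.is_model
    obtain ⟨v⟩ := M.nonempty'
    obtain ⟨f, -⟩ := exists_embedding_component hG hc.isAcyclic v
    exact Infinite.of_injective f f.injective

end RegularTree
end

section
/- Let G be an acyclic simple graph and let a₁, a₂ be vertices of G in the same connected component with dist(a₁,a₂) = d. If b is a vertex with dist(b,a₁) = k₁ and dist(b,a₂) = k₂ (in particular b is connected to a₁ and a₂), then d ≤ k₁ + k₂ and the distance from b to the set P(a₁,a₂) equals (k₁ + k₂ − d)/2. -/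
namespace InfiniteBranchingTree

/-- The distance from a vertex `b` to a set `S` of vertices: the minimum of the
distances from `b` to the elements of `S` connected to `b`. -/
noncomputable def distToSet {V : Type*} (G : SimpleGraph V) (b : V) (S : Set V) : ℕ :=
  sInf {n | ∃ s ∈ S, G.Reachable b s ∧ G.dist b s = n}

/-- In an acyclic graph, every path is a shortest walk between its endpoints. -/
theorem length_eq_dist_of_isPath {V : Type*} {G : SimpleGraph V} (hG : G.IsAcyclic) {u v : V}
    {p : G.Walk u v} (hp : p.IsPath) : p.length = G.dist u v := by
  obtain ⟨q, hq, hlen⟩ := p.reachable.exists_path_of_dist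
  rw [← hlen]
  have := hG.subsingleton_path u v
  exact congrArg (fun r : G.Path u v ↦ r.1.length) (Subsingleton.elim ⟨p, hp⟩ ⟨q, hq⟩)

/-- Two paths that share only the vertex at which they meet concatenate to a path. -/
theorem isPath_append_of_inter_support {V : Type*} {G : SimpleGraph V} {u v w : V}
    {p : G.Walk u v} {q : G.Walk v w} (hp : p.IsPath) (hq : q.IsPath)
    (h : ∀ x ∈ p.support, x ∈ q.support → x = v) : (p.append q).IsPath := by
  have hq' := hq.support_nodup
  rw [← q.cons_tail_support, List.nodup_cons] at hq'
  rw [SimpleGraph.Walk.isPath_def, SimpleGraph.Walk.support_append]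
  refine hp.support_nodup.append hq'.2 fun x hxp hxq ↦ hq'.1 ?_
  exact h x hxp (List.mem_of_mem_tail hxq) ▸ hxq

/-- In an acyclic graph, if `m` is a vertex of the path `p` nearest to `b`, then a shortest path
from `b` to an endpoint of `p` passes through `m`. -/
theorem dist_eq_add_of_forall_dist_le {V : Type*} {G : SimpleGraph V} (hG : G.IsAcyclic)
    {b m a : V} {p : G.Walk m a} (hp : p.IsPath) (hbm : G.Reachable b m)
    (hmin : ∀ x ∈ p.support, G.dist b m ≤ G.dist b x) :
    G.dist b a = G.dist b m + G.dist m a := by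
  classical
  obtain ⟨q, hq, hlen⟩ := hbm.exists_path_of_dist
  have happ : (q.append p).IsPath := by
    refine isPath_append_of_inter_support hq hp fun x hxq hxp ↦ ?_
    by_contra hne
    have := q.length_takeUntil_lt_length hxq hne
    have := SimpleGraph.dist_le (q.takeUntil x hxq)
    have := hmin x hxp
    lia
  rw [← length_eq_dist_of_isPath hG happ, SimpleGraph.Walk.length_append, hlen,
    length_eq_dist_of_isPath hG hp]

/-- Let `G` be an acyclic simple graph, `a₁`, `a₂` vertices in the
same connected component with `dist(a₁, a₂) = d`, and let `p` be the (unique) path from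
`a₁` to `a₂`.  If `b` is a vertex with `dist(b, a₁) = k₁` and `dist(b, a₂) = k₂`, then
`d ≤ k₁ + k₂` and the distance from `b` to the vertex set of `p` equals
`(k₁ + k₂ − d)/2`. -/
theorem dist_to_path {V : Type*} (G : SimpleGraph V) (hG : G.IsAcyclic)
    (a₁ a₂ b : V) (d k₁ k₂ : ℕ)
    (h12 : G.Reachable a₁ a₂) (hd : G.dist a₁ a₂ = d)
    (h1 : G.Reachable b a₁) (hk1 : G.dist b a₁ = k₁)
    (h2 : G.Reachable b a₂) (hk2 : G.dist b a₂ = k₂)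
    (p : G.Walk a₁ a₂) (hp : p.IsPath) :
    d ≤ k₁ + k₂ ∧ 2 * distToSet G b {v | v ∈ p.support} = k₁ + k₂ - d := by
  classical
  subst hd hk1 hk2
  obtain ⟨m, hm, hbm, hdist⟩ := Nat.sInf_mem
    (s := {n | ∃ s ∈ {v | v ∈ p.support}, G.Reachable b s ∧ G.dist b s = n})
    ⟨_, a₁, p.start_mem_support, h1, rfl⟩
  have hmin : ∀ x ∈ p.support, G.dist b m ≤ G.dist b x := fun x hx ↦
    hdist.trans_le (Nat.sInf_le ⟨x, hx, h1.trans (p.takeUntil x hx).reachable, rfl⟩)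
  have hm : m ∈ p.support := hm
  have hleft := dist_eq_add_of_forall_dist_le hG (hp.takeUntil hm).reverse hbm fun x hx ↦
    hmin x (p.support_takeUntil_subset_support hm (by simpa using hx))
  have hright := dist_eq_add_of_forall_dist_le hG (hp.dropUntil hm) hbm fun x hx ↦
    hmin x (p.support_dropUntil_subset_support hm hx)
  have hsplit := congrArg SimpleGraph.Walk.length (p.take_spec hm)
  rw [SimpleGraph.Walk.length_append, length_eq_dist_of_isPath hG hp,
    length_eq_dist_of_isPath hG (hp.takeUntil hm),
    length_eq_dist_of_isPath hG (hp.dropUntil hm), G.dist_comm (u := a₁) (v := m)] at hsplit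
  change _ ∧ 2 * sInf _ = _
  rw [← hdist]
  lia

end InfiniteBranchingTree
end

section
/- Let d, g : ℕ → ℕ be functions with d(k) → ∞ as k → ∞. Then there exists a family (H_k) of finite simple graphs such that: (1) the number of vertices |H_k| tends to infinity as k → ∞; (2) each H_k is d(k)-regular; and (3) each H_k has no cycle of length less than 3·g(k) (its girth is at least 3·g(k)). -/
namespace InfiniteBranchingTree

/-- Words of length at most `N` over the alphabet `Fin d` in which consecutive letters differ. -/
abbrev ReducedWord (d N : ℕ) : Type :=
  {l : List (Fin d) // l.IsChain (· ≠ ·) ∧ l.length ≤ N}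

/-- The empty reduced word. -/
def emptyWord (d N : ℕ) : ReducedWord d N := ⟨[], by simp⟩

instance finite_reducedWord (d N : ℕ) : Finite (ReducedWord d N) :=
  ((List.finite_length_le (Fin d) N).subset fun _ h => h.2).to_subtype

/-- Cancel a leading letter `i`, or else prepend `i` if the length bound permits it. -/
def toggleHead {d N : ℕ} (i : Fin d) (l : ReducedWord d N) : ReducedWord d N :=
  if l.1.head? = some i then ⟨l.1.tail, l.2.1.tail, by have := l.2.2; simp; omega⟩
  else if h : l.1.head? ≠ some i ∧ l.1.length < N then
    ⟨i :: l.1, by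
      refine ⟨List.isChain_cons.2 ⟨fun y hy hiy => h.1 ?_, l.2.1⟩, by simpa using h.2⟩
      subst hiy
      exact hy⟩
  else l

lemma toggleHead_val_of_ne {d N : ℕ} {i : Fin d} {l : ReducedWord d N}
    (hi : l.1.head? ≠ some i) (hl : l.1.length < N) : (toggleHead i l).1 = i :: l.1 := by
  simp [toggleHead, hi, hl]

lemma toggleHead_involutive {d N : ℕ} (i : Fin d) :
    Function.Involutive (toggleHead (N := N) i) := by
  rintro ⟨l, hc, hl⟩
  apply Subtype.ext
  by_cases hi : l.head? = some i
  · obtain ⟨t, rfl⟩ := List.head?_eq_some_iff.1 hi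
    have ht : toggleHead i ⟨i :: t, hc, hl⟩ =
        (⟨t, hc.tail, by simp at hl; omega⟩ : ReducedWord d N) := by
      simp [toggleHead]
    rw [ht, toggleHead_val_of_ne]
    · exact fun h => (List.isChain_cons.1 hc).1 i h rfl
    · simpa using hl
  · by_cases hlt : l.length < N
    · have h := toggleHead_val_of_ne (l := (⟨l, hc, hl⟩ : ReducedWord d N)) hi hlt
      generalize toggleHead i ⟨l, hc, hl⟩ = m at h
      simp [toggleHead, h]
    · simp [toggleHead, hi, hlt]

/-- `toggleHead i` as a permutation of the reduced words. -/
def togglePerm {d : ℕ} (N : ℕ) (i : Fin d) : Equiv.Perm (ReducedWord d N) :=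
  (toggleHead_involutive i).toPerm

lemma togglePerm_mul_self {d N : ℕ} (i : Fin d) : togglePerm N i * togglePerm N i = 1 :=
  Equiv.ext (toggleHead_involutive i)

lemma togglePerm_emptyWord {d N : ℕ} (hN : 0 < N) (i : Fin d) :
    (togglePerm N i (emptyWord d N)).1 = [i] :=
  toggleHead_val_of_ne (by simp [emptyWord]) hN

lemma togglePerm_injective {d N : ℕ} (hN : 0 < N) :
    Function.Injective (togglePerm (d := d) N) := by
  intro i j h
  have := togglePerm_emptyWord hN i
  rw [h, togglePerm_emptyWord hN j] at this
  simpa using this.symm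

lemma togglePerm_ne_one {d N : ℕ} (hN : 0 < N) (i : Fin d) : togglePerm N i ≠ 1 := by
  intro h
  have := togglePerm_emptyWord hN i
  simp [h, emptyWord] at this

/-- The Cayley graph of the permutations of reduced words with respect to the toggles. -/
def toggleGraph (d N : ℕ) (hN : 0 < N) : SimpleGraph (Equiv.Perm (ReducedWord d N)) where
  Adj u v := ∃ i, v = u * togglePerm N i
  symm := ⟨by
    rintro u v ⟨i, rfl⟩
    exact ⟨i, by rw [mul_assoc, togglePerm_mul_self, mul_one]⟩⟩
  loopless := ⟨by
    rintro u ⟨i, h⟩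
    exact togglePerm_ne_one hN i (left_eq_mul.1 h)⟩

lemma ncard_neighborSet_toggleGraph (d N : ℕ) (hN : 0 < N)
    (u : Equiv.Perm (ReducedWord d N)) :
    ((toggleGraph d N hN).neighborSet u).ncard = d := by
  have h : (toggleGraph d N hN).neighborSet u = Set.range fun i => u * togglePerm N i := by
    ext v
    simp [toggleGraph, eq_comm]
  have hinj : Function.Injective fun i => u * togglePerm (d := d) N i :=
    (mul_right_injective u).comp (togglePerm_injective hN)
  rw [h, ← Set.image_univ, Set.ncard_image_of_injective _ hinj]
  simp

/-- The labels along a short trail form a reduced word, recovered from the action of the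
endpoints on the empty word. -/
lemma length_of_isTrail {d N : ℕ} {hN : 0 < N} {u v : Equiv.Perm (ReducedWord d N)}
    (p : (toggleGraph d N hN).Walk u v) (hp : p.IsTrail) (hl : p.length ≤ N) :
    ((u⁻¹ * v) (emptyWord d N)).1.length = p.length ∧
      ∀ i, ((u⁻¹ * v) (emptyWord d N)).1.head? = some i →
        s(u, u * togglePerm N i) ∈ p.edges := by
  induction p with
  | nil => simp [emptyWord]
  | @cons u v w h p ih =>
    rw [SimpleGraph.Walk.length_cons] at hl
    rw [SimpleGraph.Walk.isTrail_cons] at hp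
    obtain ⟨hlen, hhead⟩ := ih hp.1 (by omega)
    obtain ⟨i, rfl⟩ := id h
    have key : ((u⁻¹ * w) (emptyWord d N)).1 =
        i :: (((u * togglePerm N i)⁻¹ * w) (emptyWord d N)).1 := by
      have hmul : u⁻¹ * w = togglePerm N i * ((u * togglePerm N i)⁻¹ * w) := by group
      rw [hmul, Equiv.Perm.mul_apply]
      refine toggleHead_val_of_ne (fun hi => hp.2 ?_) (by omega)
      have := hhead i hi
      rwa [mul_assoc, togglePerm_mul_self, mul_one, Sym2.eq_swap] at this
    rw [key]
    refine ⟨by rw [List.length_cons, hlen, SimpleGraph.Walk.length_cons], fun j hj => ?_⟩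
    obtain rfl : i = j := by simpa using hj
    simp

lemma le_egirth_toggleGraph (d N : ℕ) (hN : 0 < N) :
    (N : ℕ∞) ≤ (toggleGraph d N hN).egirth := by
  rw [SimpleGraph.le_egirth]
  intro u p hp
  by_contra! hlt
  have hlt' : p.length < N := by exact_mod_cast hlt
  have h := (length_of_isTrail p hp.isTrail hlt'.le).1
  have h3 := hp.three_le_length
  simp [emptyWord] at h
  omega

/-- (Proposition `nhedron`.)  Let `d, g : ℕ → ℕ` with `d k → ∞`.
Then there is a family `(H k)` of finite simple graphs such that (1) the number of
vertices of `H k` tends to infinity, (2) each `H k` is `d k`-regular, and (3) each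
`H k` has no cycle of length less than `3 * g k`. -/
theorem exists_regular_large_girth_family (d g : ℕ → ℕ)
    (hd : Filter.Tendsto d Filter.atTop Filter.atTop) :
    ∃ (V : ℕ → Type) (_ : ∀ k, Fintype (V k)) (H : ∀ k, SimpleGraph (V k)),
      Filter.Tendsto (fun k => Nat.card (V k)) Filter.atTop Filter.atTop ∧
      (∀ k (v : V k), ((H k).neighborSet v).ncard = d k) ∧
      (∀ k, ((3 * g k : ℕ) : ℕ∞) ≤ (H k).egirth) := by
  refine ⟨fun k => Equiv.Perm (ReducedWord (d k) (3 * g k + 1)), fun k => Fintype.ofFinite _,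
    fun k => toggleGraph (d k) (3 * g k + 1) (Nat.succ_pos _), ?_,
    fun k => ncard_neighborSet_toggleGraph _ _ _, fun k => ?_⟩
  · refine Filter.tendsto_atTop_mono (fun k => ?_) hd
    rw [← ncard_neighborSet_toggleGraph (d k) (3 * g k + 1) (Nat.succ_pos _) 1]
    exact Set.ncard_le_card _
  · exact le_trans (by exact_mod_cast Nat.le_succ _) (le_egirth_toggleGraph _ _ _)

end InfiniteBranchingTree
end
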